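/- Let ℱ be a fully Δ-capturing construction scheme whose type satisfies n_{k+1} ≥ 2^{m_k} for all k, let n ≥ 1, and let 𝔼_e = {e_α : α < ω₁} be defined as in the context. Then 𝔼_e, as a subset of the lexicographically ordered integer sequences ℤ^ω, is 2n-entangled. -/

import Mathlib

noncomputable section

open scoped Classical

/-- The first uncountable ordinal. -/
def omegaOne : Ordinal := (Cardinal.aleph 1).ord

/-- A scheme type. -/
structure SchemeType where
  m : ℕ → ℕ
  n : ℕ → ℕ
  r : ℕ → ℕ
  m_zero : m 0 = 1
  n_ge : ∀ k, 2 ≤ n (k + 1)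
  r_lt : ∀ k, r (k + 1) < m k
  m_succ : ∀ k, m (k + 1) = r (k + 1) + (m k - r (k + 1)) * n (k + 1)

/-- `A` is an initial segment of `B`. -/
def InitSeg (A B : Finset Ordinal) : Prop := ∀ a ∈ A, ∀ b ∈ B, b < a → b ∈ A

/-- `D`, `R` form the canonical decomposition of `F ∈ ℱ_{k+1}`. -/
def IsDecomposition (T : SchemeType) (ℱ : Set (Finset Ordinal)) (k : ℕ)
    (F : Finset Ordinal) (D : ℕ → Finset Ordinal) (R : Finset Ordinal) : Prop :=
  (∀ i < T.n (k + 1), D i ∈ ℱ ∧ (D i).card = T.m k) ∧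
  F = (Finset.range (T.n (k + 1))).biUnion D ∧
  R.card = T.r (k + 1) ∧
  (∀ i < T.n (k + 1), ∀ j < T.n (k + 1), i ≠ j → D i ∩ D j = R) ∧
  (∀ i < T.n (k + 1), ∀ x ∈ R, ∀ y ∈ D i \ R, x < y) ∧
  (∀ i j, i < j → j < T.n (k + 1) → ∀ x ∈ D i \ R, ∀ y ∈ D j \ R, x < y)

/-- `ℱ` is a construction scheme of type `T` on `ω₁`. -/
structure IsConstructionScheme (T : SchemeType) (ℱ : Set (Finset Ordinal)) : Prop where
  nonempty_mem : ∀ F ∈ ℱ, F.Nonempty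
  mem_subset : ∀ F ∈ ℱ, ↑F ⊆ Set.Iio omegaOne
  cofinal : ∀ A : Finset Ordinal, ↑A ⊆ Set.Iio omegaOne → ∃ F ∈ ℱ, A ⊆ F
  card_eq : ∀ F ∈ ℱ, ∃ k, F.card = T.m k
  inter_initSeg : ∀ k : ℕ, ∀ E ∈ ℱ, ∀ F ∈ ℱ, E.card = T.m k → F.card = T.m k →
    InitSeg (E ∩ F) E ∧ InitSeg (E ∩ F) F
  decomp : ∀ k : ℕ, ∀ F ∈ ℱ, F.card = T.m (k + 1) → ∃ D R, IsDecomposition T ℱ k F D R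

/-- `ρ(α,β)`: least `k` such that `{α,β}` is included in a member of `ℱ_k`. -/
def rho (T : SchemeType) (ℱ : Set (Finset Ordinal)) (α β : Ordinal) : ℕ :=
  sInf {k | ∃ F ∈ ℱ, F.card = T.m k ∧ α ∈ F ∧ β ∈ F}

/-- `‖α‖_k`, the cardinality of `(α)_k \ {α}`. -/
def nrm (T : SchemeType) (ℱ : Set (Finset Ordinal)) (α : Ordinal) (k : ℕ) : ℕ :=
  Set.ncard {ξ : Ordinal | ξ < α ∧ rho T ℱ α ξ ≤ k}

/-- `Δ(α,β)`: least `k` with `‖α‖_k ≠ ‖β‖_k`. -/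
def deltaOrd (T : SchemeType) (ℱ : Set (Finset Ordinal)) (α β : Ordinal) : ℕ :=
  sInf {k | nrm T ℱ α k ≠ nrm T ℱ β k}

/-- `Ξ_α(k)`. -/
def Xi (T : SchemeType) (ℱ : Set (Finset Ordinal)) (α : Ordinal) (k : ℕ) : ℤ :=
  if k = 0 then 0
  else if h : ∃ i : ℕ, ∃ F ∈ ℱ, ∃ D R, F.card = T.m k ∧ α ∈ F ∧
      IsDecomposition T ℱ (k - 1) F D R ∧ i < T.n k ∧ α ∈ D i ∧ α ∉ R
  then (h.choose : ℤ) else -1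

/-- The `a`-th element of a finite set of ordinals, in increasing order. -/
def elt (A : Finset Ordinal) (a : ℕ) : Ordinal := (A.sort (· ≤ ·)).getD a 0

/-- The family `⟨D_0, …, D_{j-1}⟩` is Δ-captured at level `l`. -/
def DeltaCapturedFam (T : SchemeType) (ℱ : Set (Finset Ordinal)) (j : ℕ)
    (D : ℕ → Finset Ordinal) (l : ℕ) : Prop :=
  ∃ R : Finset Ordinal,
    (∀ i < j, ∀ i' < j, (D i).card = (D i').card) ∧
    (∀ i < j, ∀ i' < j, i ≠ i' → D i ∩ D i' = R) ∧
    (∀ i < j, ∀ x ∈ R, ∀ y ∈ D i \ R, x < y) ∧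
    (∀ i i', i < i' → i' < j → ∀ x ∈ D i \ R, ∀ y ∈ D i' \ R, x < y) ∧
    (∀ i < j, ∀ a < R.card, Xi T ℱ (elt (D i) a) l = -1) ∧
    (∀ i < j, ∀ a, R.card ≤ a → a < (D i).card → Xi T ℱ (elt (D i) a) l = (i : ℤ)) ∧
    (∀ i < j, ∀ i' < j, i ≠ i' → ∀ a, R.card ≤ a → a < (D i).card →
      deltaOrd T ℱ (elt (D i) a) (elt (D i') a) = l)

/-- The family `⟨D_0, …, D_{j-1}⟩` is captured at level `l`. -/
def CapturedFam (T : SchemeType) (ℱ : Set (Finset Ordinal)) (j : ℕ)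
    (D : ℕ → Finset Ordinal) (l : ℕ) : Prop :=
  DeltaCapturedFam T ℱ j D l ∧
  ∀ i < j, ∀ i' < j, i ≠ i' → ∀ a, (D i ∩ D i').card ≤ a → a < (D i).card →
    rho T ℱ (elt (D i) a) (elt (D i') a) = l

/-- The ordered pair `⟨A, B⟩`, as a family. -/
def pairFam (A B : Finset Ordinal) : ℕ → Finset Ordinal := fun i => if i = 0 then A else B

/-- A pair of ordinals `α < β` is captured at level `l`, i.e. `⟨{α},{β}⟩` is. -/
def CapturedPair (T : SchemeType) (ℱ : Set (Finset Ordinal)) (α β : Ordinal) (l : ℕ) : Prop :=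
  α < β ∧ Xi T ℱ α l = 0 ∧ Xi T ℱ β l = 1 ∧ deltaOrd T ℱ α β = l ∧ rho T ℱ α β = l

/-- `ℱ` is a 2-Δ-capturing scheme. -/
def TwoDeltaCapturing (T : SchemeType) (ℱ : Set (Finset Ordinal)) : Prop :=
  ∀ 𝒮 : Set (Finset Ordinal), (∀ A ∈ 𝒮, A.Nonempty ∧ ↑A ⊆ Set.Iio omegaOne) →
    ¬ 𝒮.Countable →
    {l : ℕ | ∃ A ∈ 𝒮, ∃ B ∈ 𝒮, A ≠ B ∧ DeltaCapturedFam T ℱ 2 (pairFam A B) l}.Infinite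

/-- `ℱ` is a 2-capturing scheme. -/
def TwoCapturing (T : SchemeType) (ℱ : Set (Finset Ordinal)) : Prop :=
  ∀ 𝒮 : Set (Finset Ordinal), (∀ A ∈ 𝒮, A.Nonempty ∧ ↑A ⊆ Set.Iio omegaOne) →
    ¬ 𝒮.Countable →
    {l : ℕ | ∃ A ∈ 𝒮, ∃ B ∈ 𝒮, A ≠ B ∧ CapturedFam T ℱ 2 (pairFam A B) l}.Infinite

/-- `ℱ` is a fully Δ-capturing scheme. -/
def FullyDeltaCapturing (T : SchemeType) (ℱ : Set (Finset Ordinal)) : Prop :=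
  ∀ 𝒮 : Set (Finset Ordinal), (∀ A ∈ 𝒮, A.Nonempty ∧ ↑A ⊆ Set.Iio omegaOne) →
    ¬ 𝒮.Countable →
    {l : ℕ | ∃ D : ℕ → Finset Ordinal, (∀ i < T.n l, D i ∈ 𝒮) ∧
      (∀ i < T.n l, ∀ i' < T.n l, i ≠ i' → D i ≠ D i') ∧
      DeltaCapturedFam T ℱ (T.n l) D l}.Infinite

/-- `E` is an `n`-entangled subset of the linear order `X`. -/
def IsNEntangled {X : Type*} [LinearOrder X] (E : Set X) (n : ℕ) : Prop :=
  ¬ E.Countable ∧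
  ∀ τ : Fin n → Fin 2, ∀ 𝒜 : Set (Fin n → X),
    (∀ a ∈ 𝒜, StrictMono a ∧ ∀ i, a i ∈ E) →
    (𝒜.Pairwise fun a b => ∀ i j, a i ≠ b j) →
    ¬ 𝒜.Countable →
    ∃ a ∈ 𝒜, ∃ b ∈ 𝒜, a ≠ b ∧ ∀ i, (a i < b i ↔ τ i = 0)


/-- The sequence `e_α` (depending on a parameter `nn` and the chosen enumerations `C`). -/
def eSeq (T : SchemeType) (ℱ : Set (Finset Ordinal)) (C : ℕ → ℕ → Finset ℕ) (nn : ℕ)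
    (α : Ordinal) : ℕ → ℤ := fun k =>
  if Xi T ℱ α k ≤ 0 then 0
  else if nrm T ℱ α (k - 1) ∈ C (k - 1) (Xi T ℱ α k).toNat ∨
      ((C (k - 1) (Xi T ℱ α k).toNat).card = nn ∧
        ∀ c ∈ C (k - 1) (Xi T ℱ α k).toNat, nrm T ℱ α (k - 1) < c)
  then Xi T ℱ α k
  else -(Xi T ℱ α k)

/-- The sequence `o_α` (depending on the chosen enumerations `C`). -/
def oSeq (T : SchemeType) (ℱ : Set (Finset Ordinal)) (C : ℕ → ℕ → Finset ℕ)
    (α : Ordinal) : ℕ → ℤ := fun k =>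
  if Xi T ℱ α k ≤ 0 then 0
  else if nrm T ℱ α (k - 1) ∈ C (k - 1) (Xi T ℱ α k).toNat
  then Xi T ℱ α k
  else -(Xi T ℱ α k)

/-- `C` is an enumeration `⟨C^k_i⟩_{0<i<n_{k+1}}` (possibly with repetitions) of all subsets of
`m_k ∖ r_{k+1}` of cardinality at most `nn`. -/
def IsGoodEnum (T : SchemeType) (nn : ℕ) (C : ℕ → ℕ → Finset ℕ) : Prop :=
  (∀ k, ∀ i, 0 < i → i < T.n (k + 1) →
    C k i ⊆ Finset.Ico (T.r (k + 1)) (T.m k) ∧ (C k i).card ≤ nn) ∧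
  (∀ k, ∀ s : Finset ℕ, s ⊆ Finset.Ico (T.r (k + 1)) (T.m k) → s.card ≤ nn →
    ∃ i, 0 < i ∧ i < T.n (k + 1) ∧ C k i = s)

theorem elt_card_filter_lt {s : Finset Ordinal} {x : Ordinal} (hx : x ∈ s) :
    elt s (s.filter (· < x)).card = x := by
  obtain ⟨j, rfl⟩ : ∃ j, s.orderEmbOfFin rfl j = x := by
    have : x ∈ Set.range (s.orderEmbOfFin rfl) := by simpa using hx
    exact this
  have hf : s.filter (· < s.orderEmbOfFin rfl j) =
      (Finset.Iio j).map (s.orderEmbOfFin rfl).toEmbedding := by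
    ext y
    simp only [Finset.mem_filter, Finset.mem_map, Finset.mem_Iio]
    constructor
    · rintro ⟨hy, hlt⟩
      obtain ⟨i, rfl⟩ : y ∈ Set.range (s.orderEmbOfFin rfl) := by simpa using hy
      exact ⟨i, by simpa using hlt, rfl⟩
    · rintro ⟨i, hi, rfl⟩
      exact ⟨s.orderEmbOfFin_mem rfl i, by simpa using hi⟩
  have hc : (s.filter (· < s.orderEmbOfFin rfl j)).card = j := by
    rw [hf, Finset.card_map, Fin.card_Iio]
  rw [hc, elt, Finset.orderEmbOfFin_apply, List.getD_eq_getElem]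
  rfl

theorem card_filter_lt_lt_card {s : Finset Ordinal} {x : Ordinal} (hx : x ∈ s) :
    (s.filter (· < x)).card < s.card :=
  Finset.card_lt_card (Finset.filter_ssubset.2 ⟨x, hx, lt_irrefl x⟩)

namespace SchemeType

theorem m_strictMono (T : SchemeType) : StrictMono T.m := by
  refine strictMono_nat_of_lt_succ fun k => ?_
  rw [T.m_succ]
  have h1 := T.r_lt k
  have h2 : (T.m k - T.r (k + 1)) * 2 ≤ (T.m k - T.r (k + 1)) * T.n (k + 1) :=
    Nat.mul_le_mul_left _ (T.n_ge k)
  omega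

end SchemeType

namespace IsDecomposition

variable {T : SchemeType} {ℱ : Set (Finset Ordinal)} {k : ℕ} {F : Finset Ordinal}
  {D : ℕ → Finset Ordinal} {R : Finset Ordinal}

theorem root_subset (h : IsDecomposition T ℱ k F D R) {i : ℕ} (hi : i < T.n (k + 1)) :
    R ⊆ D i := by
  obtain ⟨-, -, -, h4, -, -⟩ := h
  have := T.n_ge k
  by_cases h0 : i = 0
  · rw [← h4 i hi 1 (by omega) (by omega)]
    exact Finset.inter_subset_left
  · rw [← h4 i hi 0 (by omega) h0]
    exact Finset.inter_subset_left

/-- The size of the union of the root with the first `i` blocks. -/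
theorem card_root_union (h : IsDecomposition T ℱ k F D R) {i : ℕ} (hi : i ≤ T.n (k + 1)) :
    (R ∪ (Finset.range i).biUnion fun j => D j \ R).card =
      T.r (k + 1) + i * (T.m k - T.r (k + 1)) := by
  have hR := @root_subset _ _ _ _ _ _ h
  obtain ⟨h1, -, h3, h4, -, -⟩ := h
  rw [Finset.card_union_of_disjoint, h3, Finset.card_biUnion, Finset.sum_const_nat,
    Finset.card_range]
  · intro j hj
    have hj' : j < T.n (k + 1) := by simp at hj; omega
    rw [Finset.card_sdiff_of_subset (hR hj'), (h1 j hj').2, h3]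
  · intro a ha b hb hab
    have ha' : a < T.n (k + 1) := by simp at ha; omega
    have hb' : b < T.n (k + 1) := by simp at hb; omega
    refine Finset.disjoint_left.2 fun x hx hy => ?_
    rw [Finset.mem_sdiff] at hx hy
    refine hx.2 ?_
    rw [← h4 a ha' b hb' hab]
    exact Finset.mem_inter.2 ⟨hx.1, hy.1⟩
  · refine Finset.disjoint_left.2 fun x hx hy => ?_
    simp_all

theorem card_filter_lt_of_mem_root (h : IsDecomposition T ℱ k F D R) {α : Ordinal} (hα : α ∈ R) :
    (F.filter (· < α)).card < T.r (k + 1) := by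
  have hR := @root_subset _ _ _ _ _ _ h
  obtain ⟨h1, h2, h3, h4, h5, h6⟩ := h
  rw [← h3]
  refine (Finset.card_le_card ?_).trans_lt (card_filter_lt_lt_card hα)
  intro x hx
  simp only [h2, Finset.mem_filter, Finset.mem_biUnion, Finset.mem_range] at hx ⊢
  obtain ⟨⟨i, hi, hxi⟩, hlt⟩ := hx
  refine ⟨?_, hlt⟩
  by_contra hxR
  exact (h5 i hi α hα x (by simp [*])).not_gt hlt

theorem card_filter_lt_bounds (h : IsDecomposition T ℱ k F D R) {α : Ordinal} {i : ℕ}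
    (hi : i < T.n (k + 1)) (hα : α ∈ D i) (hαR : α ∉ R) :
    T.r (k + 1) + i * (T.m k - T.r (k + 1)) ≤ (F.filter (· < α)).card ∧
    (F.filter (· < α)).card < T.r (k + 1) + (i + 1) * (T.m k - T.r (k + 1)) := by
  have hR := @root_subset _ _ _ _ _ _ h
  rw [← h.card_root_union hi.le, ← h.card_root_union (Nat.succ_le_of_lt hi)]
  obtain ⟨h1, h2, h3, h4, h5, h6⟩ := h
  constructor
  · refine Finset.card_le_card fun x hx => ?_
    simp only [h2, Finset.mem_union, Finset.mem_filter, Finset.mem_biUnion, Finset.mem_range,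
      Finset.mem_sdiff] at hx ⊢
    rcases hx with hx | ⟨j, hj, hxj, hxR⟩
    · exact ⟨⟨i, hi, hR hi hx⟩, h5 i hi x hx α (by simp [*])⟩
    · exact ⟨⟨j, by omega, hxj⟩, h6 j i hj hi x (by simp [*]) α (by simp [*])⟩
  · refine Finset.card_lt_card ((Finset.ssubset_iff_of_subset fun x hx => ?_).2 ⟨α, ?_, ?_⟩)
    · simp only [h2, Finset.mem_union, Finset.mem_filter, Finset.mem_biUnion, Finset.mem_range,
        Finset.mem_sdiff] at hx ⊢
      obtain ⟨⟨j, hj, hxj⟩, hlt⟩ := hx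
      by_cases hxR : x ∈ R
      · exact Or.inl hxR
      refine Or.inr ⟨j, ?_, hxj, hxR⟩
      by_contra hji
      exact (h6 i j (by omega) hj α (by simp [*]) x (by simp [*])).not_gt hlt
    · simp only [Finset.mem_union, Finset.mem_biUnion, Finset.mem_range, Finset.mem_sdiff]
      exact Or.inr ⟨i, by omega, hα, hαR⟩
    · simp

end IsDecomposition

namespace IsConstructionScheme

variable {T : SchemeType} {ℱ : Set (Finset Ordinal)}

theorem exists_subset_of_le (hS : IsConstructionScheme T ℱ) {j k : ℕ} (hjk : j ≤ k)
    {G : Finset Ordinal} (hG : G ∈ ℱ) (hc : G.card = T.m k) {α : Ordinal} (hα : α ∈ G) :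
    ∃ E ∈ ℱ, E.card = T.m j ∧ α ∈ E ∧ E ⊆ G := by
  induction k, hjk using Nat.le_induction generalizing G with
  | base => exact ⟨G, hG, hc, hα, subset_rfl⟩
  | succ k hjk ih =>
    obtain ⟨D, R, h1, h2, -⟩ := hS.decomp k G hG hc
    have hα' := hα
    rw [h2, Finset.mem_biUnion] at hα'
    obtain ⟨i, hi, hαi⟩ := hα'
    have hi' := h1 i (Finset.mem_range.1 hi)
    obtain ⟨E, hE, hEc, hαE, hEG⟩ := ih hi'.1 hi'.2 hαi
    refine ⟨E, hE, hEc, hαE, hEG.trans ?_⟩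
    rw [h2]
    exact Finset.subset_biUnion_of_mem D hi

theorem mem_of_le (hS : IsConstructionScheme T ℱ) {j k : ℕ} (hjk : j ≤ k)
    {F G : Finset Ordinal} (hF : F ∈ ℱ) (hFc : F.card = T.m j) (hG : G ∈ ℱ)
    (hGc : G.card = T.m k) {α ξ : Ordinal} (hαF : α ∈ F) (hαG : α ∈ G) (hξ : ξ ∈ F)
    (hlt : ξ < α) : ξ ∈ G := by
  obtain ⟨E, hE, hEc, hαE, hEG⟩ := hS.exists_subset_of_le hjk hG hGc hαG
  have := (hS.inter_initSeg j F hF E hE hFc hEc).1 α (by simp [*]) ξ hξ hlt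
  exact hEG (Finset.mem_inter.1 this).2

end IsConstructionScheme

theorem not_countable_Iio_omegaOne : ¬ (Set.Iio omegaOne).Countable := by
  rw [← Cardinal.le_aleph0_iff_set_countable, Cardinal.mk_Iio_ordinal, omegaOne,
    Cardinal.card_ord]
  simp [Cardinal.aleph_one_le_iff]

namespace IsConstructionScheme

variable {T : SchemeType} {ℱ : Set (Finset Ordinal)}

theorem exists_mem (hS : IsConstructionScheme T ℱ) {α : Ordinal} (hα : α < omegaOne) (k : ℕ) :
    ∃ F ∈ ℱ, F.card = T.m k ∧ α ∈ F := by
  have hinf : (Set.Iio omegaOne).Infinite := fun h => not_countable_Iio_omegaOne h.countable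
  obtain ⟨t, ht, htc⟩ := hinf.exists_subset_card_eq (T.m k)
  obtain ⟨F, hF, htF⟩ := hS.cofinal (insert α t) (by
    rw [Finset.coe_insert]
    exact Set.insert_subset hα ht)
  obtain ⟨j, hj⟩ := hS.card_eq F hF
  have hkj : k ≤ j := by
    rw [← T.m_strictMono.le_iff_le, ← hj, ← htc]
    exact Finset.card_le_card ((Finset.subset_insert _ _).trans htF)
  obtain ⟨E, hE, hEc, hαE, -⟩ :=
    hS.exists_subset_of_le hkj hF hj (htF (Finset.mem_insert_self _ _))
  exact ⟨E, hE, hEc, hαE⟩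

theorem rho_le_iff (hS : IsConstructionScheme T ℱ) {k : ℕ} {F : Finset Ordinal} (hF : F ∈ ℱ)
    (hFc : F.card = T.m k) {α ξ : Ordinal} (hα : α ∈ F) (hlt : ξ < α) :
    rho T ℱ α ξ ≤ k ↔ ξ ∈ F := by
  constructor
  · intro h
    have hα' : α < omegaOne := hS.mem_subset F hF hα
    have hne : {k | ∃ F ∈ ℱ, F.card = T.m k ∧ α ∈ F ∧ ξ ∈ F}.Nonempty := by
      obtain ⟨E, hE, hsub⟩ := hS.cofinal {α, ξ} (by
        rw [Finset.coe_pair]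
        exact Set.pair_subset hα' (hlt.trans hα'))
      obtain ⟨j, hj⟩ := hS.card_eq E hE
      exact ⟨j, E, hE, hj, hsub (by simp), hsub (by simp)⟩
    obtain ⟨E, hE, hEc, hαE, hξE⟩ := Nat.sInf_mem hne
    exact hS.mem_of_le h hE hEc hF hFc hαE hα hξE hlt
  · exact fun h => Nat.sInf_le ⟨F, hF, hFc, hα, h⟩

theorem nrm_eq (hS : IsConstructionScheme T ℱ) {k : ℕ} {F : Finset Ordinal} (hF : F ∈ ℱ)
    (hFc : F.card = T.m k) {α : Ordinal} (hα : α ∈ F) :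
    nrm T ℱ α k = (F.filter (· < α)).card := by
  rw [nrm, ← Set.ncard_coe_finset]
  congr 1
  ext ξ
  simp only [Set.mem_ofPred_eq, Finset.coe_filter, and_comm (a := ξ ∈ F)]
  exact and_congr_right fun h => hS.rho_le_iff hF hFc hα h

theorem nrm_lt_m (hS : IsConstructionScheme T ℱ) {α : Ordinal} (hα : α < omegaOne) (k : ℕ) :
    nrm T ℱ α k < T.m k := by
  obtain ⟨F, hF, hFc, hαF⟩ := hS.exists_mem hα k
  rw [hS.nrm_eq hF hFc hαF, ← hFc]
  exact card_filter_lt_lt_card hαF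

theorem nrm_lt_nrm (hS : IsConstructionScheme T ℱ) {j k : ℕ} (hjk : j ≤ k)
    {F : Finset Ordinal} (hF : F ∈ ℱ) (hFc : F.card = T.m j) {α β : Ordinal} (hα : α ∈ F)
    (hβ : β ∈ F) (hlt : α < β) : nrm T ℱ α k < nrm T ℱ β k := by
  obtain ⟨G, hG, hGc, hβG⟩ := hS.exists_mem (hS.mem_subset F hF hβ) k
  have hαG := hS.mem_of_le hjk hF hFc hG hGc hβ hβG hα hlt
  rw [hS.nrm_eq hG hGc hαG, hS.nrm_eq hG hGc hβG]
  refine Finset.card_lt_card ((Finset.ssubset_iff_of_subset fun x hx => ?_).2 ⟨α, ?_, ?_⟩)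
  · simp only [Finset.mem_filter] at hx ⊢
    exact ⟨hx.1, hx.2.trans hlt⟩
  · simp [*]
  · simp

theorem Xi_succ (hS : IsConstructionScheme T ℱ) {α : Ordinal} (hα : α < omegaOne) (k : ℕ) :
    Xi T ℱ α (k + 1) = if nrm T ℱ α (k + 1) < T.r (k + 1) then -1
      else (((nrm T ℱ α (k + 1) - T.r (k + 1)) / (T.m k - T.r (k + 1)) : ℕ) : ℤ) := by
  have hr := T.r_lt k
  rw [Xi, if_neg (Nat.succ_ne_zero k)]
  split_ifs with h hlt hlt
  · obtain ⟨F, hF, D, R, hFc, hαF, hD, hi, hαi, hαR⟩ := h.choose_spec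
    have := (hD.card_filter_lt_bounds hi hαi hαR).1
    rw [← hS.nrm_eq hF hFc hαF] at this
    simp only [Nat.add_sub_cancel] at this
    omega
  · obtain ⟨F, hF, D, R, hFc, hαF, hD, hi, hαi, hαR⟩ := h.choose_spec
    have := hD.card_filter_lt_bounds hi hαi hαR
    rw [← hS.nrm_eq hF hFc hαF] at this
    simp only [Nat.add_sub_cancel] at this
    congr 1
    symm
    refine Nat.div_eq_of_lt_le ?_ ?_
    · omega
    · rw [add_one_mul] at this ⊢
      omega
  · rfl
  · exfalso
    obtain ⟨F, hF, hFc, hαF⟩ := hS.exists_mem hα (k + 1)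
    obtain ⟨D, R, hD⟩ := hS.decomp k F hF hFc
    by_cases hαR : α ∈ R
    · have := hD.card_filter_lt_of_mem_root hαR
      rw [← hS.nrm_eq hF hFc hαF] at this
      exact hlt this
    · have hα' := hαF
      rw [hD.2.1, Finset.mem_biUnion] at hα'
      obtain ⟨i, hi, hαi⟩ := hα'
      exact h ⟨i, F, hF, D, R, hFc, hαF, hD, Finset.mem_range.1 hi, hαi, hαR⟩

theorem Xi_eq_of_nrm_eq (hS : IsConstructionScheme T ℱ) {α β : Ordinal} (hα : α < omegaOne)
    (hβ : β < omegaOne) {k : ℕ} (h : nrm T ℱ α k = nrm T ℱ β k) : Xi T ℱ α k = Xi T ℱ β k := by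
  cases k with
  | zero => simp [Xi]
  | succ k => rw [hS.Xi_succ hα, hS.Xi_succ hβ, h]

theorem r_le_nrm (hS : IsConstructionScheme T ℱ) {α : Ordinal} {k : ℕ}
    (h : 0 ≤ Xi T ℱ α (k + 1)) : T.r (k + 1) ≤ nrm T ℱ α k := by
  rw [Xi, if_neg (Nat.succ_ne_zero k)] at h
  split_ifs at h with h'
  · obtain ⟨F, hF, D, R, hFc, hαF, hD, hi, hαi, hαR⟩ := h'.choose_spec
    have hR := hD.root_subset hi
    obtain ⟨h1, -, h3, -, h5, -⟩ := hD
    rw [Nat.add_sub_cancel] at h1 h3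
    rw [hS.nrm_eq (h1 _ hi).1 (h1 _ hi).2 hαi]
    refine h3.symm.trans_le (Finset.card_le_card fun x hx => ?_)
    exact Finset.mem_filter.2 ⟨hR hx, h5 _ hi x hx α (Finset.mem_sdiff.2 ⟨hαi, hαR⟩)⟩
  · omega

theorem eSeq_eq_of_lt_deltaOrd (hS : IsConstructionScheme T ℱ) (C : ℕ → ℕ → Finset ℕ) (nn : ℕ)
    {α β : Ordinal} (hα : α < omegaOne) (hβ : β < omegaOne) {k : ℕ} (h : k < deltaOrd T ℱ α β) :
    eSeq T ℱ C nn α k = eSeq T ℱ C nn β k := by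
  have key : ∀ j ≤ k, nrm T ℱ α j = nrm T ℱ β j := fun j hj => by
    simpa using Nat.notMem_of_lt_sInf (hj.trans_lt h)
  rw [eSeq, eSeq, hS.Xi_eq_of_nrm_eq hα hβ (key k le_rfl), key (k - 1) (Nat.sub_le k 1)]

end IsConstructionScheme

theorem exists_not_countable_fiber {X Y : Type*} {s : Set X} (hs : ¬ s.Countable) {f : X → Y}
    (hf : (f '' s).Countable) : ∃ y, ¬ {x ∈ s | f x = y}.Countable := by
  by_contra! h
  refine hs ((hf.biUnion fun y _ => h y).mono fun x hx => ?_)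
  exact Set.mem_biUnion (Set.mem_image_of_mem f hx) ⟨hx, rfl⟩

theorem not_countable_image {X Y : Type*} {s : Set X} (hs : ¬ s.Countable) {f : X → Y}
    (hf : Set.InjOn f s) : ¬ (f '' s).Countable :=
  fun h => hs (Set.countable_of_injective_of_countable_image hf h)

/-- In a Δ-captured family of disjoint sets the root is empty. -/
theorem DeltaCapturedFam.of_disjoint {T : SchemeType} {ℱ : Set (Finset Ordinal)} {j l : ℕ}
    {D : ℕ → Finset Ordinal} (h : DeltaCapturedFam T ℱ j D l) (hj : 2 ≤ j)
    (hD : ∀ i < j, ∀ i' < j, i ≠ i' → Disjoint (D i) (D i')) :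
    (∀ i < j, ∀ x ∈ D i, Xi T ℱ x l = i) ∧
    ∀ i < j, ∀ i' < j, i ≠ i' → ∀ x ∈ D i, ∀ y ∈ D i',
      ((D i).filter (· < x)).card = ((D i').filter (· < y)).card → deltaOrd T ℱ x y = l := by
  obtain ⟨R, -, h2, -, -, -, h6, h7⟩ := h
  obtain rfl : R = ∅ := by
    rw [← h2 0 (by omega) 1 (by omega) (by omega)]
    exact Finset.disjoint_iff_inter_eq_empty.1 (hD 0 (by omega) 1 (by omega) (by omega))
  constructor
  · intro i hi x hx
    rw [← h6 i hi _ (Nat.zero_le _) (card_filter_lt_lt_card hx), elt_card_filter_lt hx]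
  · intro i hi i' hi' hne x hx y hy hxy
    have := h7 i hi i' hi' hne _ (Nat.zero_le _) (card_filter_lt_lt_card hx)
    rwa [elt_card_filter_lt hx, hxy, elt_card_filter_lt hy] at this

section eSeq

variable {T : SchemeType} {ℱ : Set (Finset Ordinal)} {C : ℕ → ℕ → Finset ℕ} {nn : ℕ}
  {α β : Ordinal}

theorem eSeq_of_Xi_nonpos {l : ℕ} (h : Xi T ℱ α l ≤ 0) : eSeq T ℱ C nn α l = 0 := by
  rw [eSeq, if_pos h]

theorem eSeq_of_pos {l i : ℕ} (hi : 0 < i) (h : Xi T ℱ α (l + 1) = i)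
    (hC : nrm T ℱ α l ∈ C l i) : eSeq T ℱ C nn α (l + 1) = i := by
  have : ¬ Xi T ℱ α (l + 1) ≤ 0 := by omega
  rw [eSeq, if_neg this, h, if_pos]
  exact Or.inl hC

theorem eSeq_of_neg {l i : ℕ} (hi : 0 < i) (h : Xi T ℱ α (l + 1) = i)
    (hC : nrm T ℱ α l ∉ C l i)
    (hC' : ¬ ((C l i).card = nn ∧ ∀ c ∈ C l i, nrm T ℱ α l < c)) :
    eSeq T ℱ C nn α (l + 1) = -i := by
  have : ¬ Xi T ℱ α (l + 1) ≤ 0 := by omega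
  rw [eSeq, if_neg this, h, if_neg]
  exact not_or.2 ⟨hC, hC'⟩

theorem eSeq_ne_zero {l : ℕ} (h : 0 < Xi T ℱ α l) : eSeq T ℱ C nn α l ≠ 0 := by
  rw [eSeq, if_neg h.not_ge]
  split_ifs <;> omega

theorem toLex_eSeq_lt (hS : IsConstructionScheme T ℱ) (hα : α < omegaOne) (hβ : β < omegaOne)
    {l : ℕ} (hl : l ≤ deltaOrd T ℱ α β) (h : eSeq T ℱ C nn α l < eSeq T ℱ C nn β l) :
    toLex (eSeq T ℱ C nn α) < toLex (eSeq T ℱ C nn β) :=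
  ⟨l, fun _ hk => hS.eSeq_eq_of_lt_deltaOrd C nn hα hβ (hk.trans_le hl), h⟩

end eSeq

theorem not_countable_range_eSeq {T : SchemeType} {ℱ : Set (Finset Ordinal)}
    (hcap : FullyDeltaCapturing T ℱ) (C : ℕ → ℕ → Finset ℕ) (nn : ℕ) :
    ¬ ((fun α => toLex (eSeq T ℱ C nn α)) '' Set.Iio omegaOne).Countable := by
  intro hE
  obtain ⟨y, hy⟩ := exists_not_countable_fiber not_countable_Iio_omegaOne hE
  have hunc := not_countable_image hy (Finset.singleton_injective.injOn)
  obtain ⟨l, ⟨D, hD, hne, hcapt⟩, hl⟩ := (hcap _ (by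
    rintro _ ⟨α, hα, rfl⟩
    simpa using hα.1) hunc).exists_gt 0
  obtain ⟨l, rfl⟩ : ∃ l', l = l' + 1 := ⟨l - 1, by omega⟩
  have hn2 := T.n_ge l
  choose! g hg hgD using hD
  have hdisj : ∀ i < T.n (l + 1), ∀ i' < T.n (l + 1), i ≠ i' → Disjoint (D i) (D i') := by
    intro i hi i' hi' hii
    have := hne i hi i' hi' hii
    rw [← hgD i hi, ← hgD i' hi'] at this ⊢
    simpa using this
  have hXi := (hcapt.of_disjoint hn2 hdisj).1
  have h0 := hXi 0 (by omega) (g 0) (by rw [← hgD 0 (by omega)]; simp)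
  have h1 := hXi 1 (by omega) (g 1) (by rw [← hgD 1 (by omega)]; simp)
  have e : eSeq T ℱ C nn (g 0) = eSeq T ℱ C nn (g 1) :=
    toLex.injective ((hg 0 (by omega)).2.trans (hg 1 (by omega)).2.symm)
  have h1pos : 0 < Xi T ℱ (g 1) (l + 1) := by simp [h1]
  refine eSeq_ne_zero (C := C) (nn := nn) h1pos ?_
  rw [← e]
  exact eSeq_of_Xi_nonpos (by simp [h0])

/-- One of a set of indices and its complement is small enough to be coded, possibly because it
contains a given index. -/
theorem exists_coded_half {nn : ℕ} (P : Finset (Fin (2 * nn))) (b₀ : Fin (2 * nn)) :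
    ∃ Q, (Q = P ∨ Q = Pᶜ) ∧ Q.card ≤ nn ∧ (Q.card = nn → b₀ ∈ Q) := by
  have hc : P.card + Pᶜ.card = 2 * nn := by simp [Finset.card_add_card_compl]
  rcases lt_trichotomy P.card nn with h | h | h
  · exact ⟨P, Or.inl rfl, h.le, fun h' => by omega⟩
  · by_cases hb : b₀ ∈ P
    · exact ⟨P, Or.inl rfl, h.le, fun _ => hb⟩
    · exact ⟨Pᶜ, Or.inr rfl, by omega, fun _ => by simpa using hb⟩
  · exact ⟨Pᶜ, Or.inr rfl, by omega, fun h' => by omega⟩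

/-- Every uncountable family of disjoint tuples contains, at arbitrarily high levels, aligned
tuples captured at that level and indexed by the blocks of that level. -/
theorem exists_captured_tuples {T : SchemeType} {ℱ : Set (Finset Ordinal)}
    (hS : IsConstructionScheme T ℱ) (hcap : FullyDeltaCapturing T ℱ) {N : ℕ} (hN : 0 < N)
    {ℬ : Set (Fin N → Ordinal)} (hℬ : ¬ ℬ.Countable)
    (hlt : ∀ a ∈ ℬ, ∀ b, a b < omegaOne) (hinj : ∀ a ∈ ℬ, Function.Injective a)
    (hdisj : ℬ.Pairwise fun a a' => ∀ b b', a b ≠ a' b') :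
    ∃ (l : ℕ) (a : ℕ → Fin N → Ordinal), (∀ i < T.n (l + 1), a i ∈ ℬ) ∧
      (∀ i < T.n (l + 1), ∀ i' < T.n (l + 1), i ≠ i' → a i ≠ a i') ∧
      (∀ i < T.n (l + 1), ∀ b, Xi T ℱ (a i b) (l + 1) = i) ∧
      (∀ i < T.n (l + 1), ∀ i' < T.n (l + 1), i ≠ i' → ∀ b,
        deltaOrd T ℱ (a i b) (a i' b) = l + 1) ∧
      ∀ i < T.n (l + 1), Function.Injective fun b => nrm T ℱ (a i b) l := by
  let S : (Fin N → Ordinal) → Finset Ordinal := fun a => Finset.univ.image a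
  have hlevel : ∀ a ∈ ℬ, ∃ k, ∃ F ∈ ℱ, F.card = T.m k ∧ S a ⊆ F := by
    intro a ha
    obtain ⟨F, hF, hsub⟩ := hS.cofinal (S a) (by
      intro x hx
      obtain ⟨b, -, rfl⟩ := Finset.mem_image.1 hx
      exact hlt a ha b)
    obtain ⟨k, hk⟩ := hS.card_eq F hF
    exact ⟨k, F, hF, hk, hsub⟩
  choose! κ hκ using hlevel
  let f : (Fin N → Ordinal) → ℕ × (Fin N → ℕ) :=
    fun a => (κ a, fun b => ((S a).filter (· < a b)).card)
  obtain ⟨⟨k₀, σ⟩, hunc⟩ := exists_not_countable_fiber hℬ (Set.to_countable (f '' ℬ))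
  have hSdisj : ∀ a ∈ ℬ, ∀ a' ∈ ℬ, a ≠ a' → Disjoint (S a) (S a') := by
    intro a ha a' ha' hne
    refine Finset.disjoint_left.2 fun x hx hx' => ?_
    obtain ⟨b, -, rfl⟩ := Finset.mem_image.1 hx
    obtain ⟨b', -, hb'⟩ := Finset.mem_image.1 hx'
    exact hdisj ha ha' hne b b' hb'.symm
  have hmem : ∀ a b, a b ∈ S a := fun a b => Finset.mem_image_of_mem a (Finset.mem_univ b)
  have hSinj : Set.InjOn S {a ∈ ℬ | f a = (k₀, σ)} := by
    intro a ha a' ha' heq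
    by_contra hne
    have h := hSdisj a ha.1 a' ha'.1 hne
    rw [← heq, disjoint_self] at h
    have h' := hmem a ⟨0, hN⟩
    rw [h] at h'
    simp at h'
  obtain ⟨l, ⟨D, hD, hne, hcapt⟩, hl⟩ := (hcap _ (by
    rintro _ ⟨a, ha, rfl⟩
    refine ⟨⟨_, hmem a ⟨0, hN⟩⟩, fun x hx => ?_⟩
    obtain ⟨b, -, rfl⟩ := Finset.mem_image.1 hx
    exact hlt a ha.1 b) (not_countable_image hunc hSinj)).exists_gt k₀
  obtain ⟨l, rfl⟩ : ∃ l', l = l' + 1 := ⟨l - 1, by omega⟩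
  have hn2 := T.n_ge l
  choose! a ha haD using hD
  have hane : ∀ i < T.n (l + 1), ∀ i' < T.n (l + 1), i ≠ i' → a i ≠ a i' := by
    intro i hi i' hi' hii heq
    apply hne i hi i' hi' hii
    rw [← haD i hi, ← haD i' hi', heq]
  have hmemD : ∀ i < T.n (l + 1), ∀ b, a i b ∈ D i := fun i hi b => by
    rw [← haD i hi]
    exact hmem _ _
  have hrank : ∀ i < T.n (l + 1), ∀ b, ((D i).filter (· < a i b)).card = σ b := fun i hi b => by
    rw [← haD i hi]
    exact congrFun (congrArg Prod.snd (ha i hi).2) b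
  obtain ⟨hXi, hΔ⟩ := hcapt.of_disjoint hn2 fun i hi i' hi' hii => by
    rw [← haD i hi, ← haD i' hi']
    exact hSdisj _ (ha i hi).1 _ (ha i' hi').1 (hane i hi i' hi' hii)
  refine ⟨l, a, fun i hi => (ha i hi).1, hane, fun i hi b => hXi i hi _ (hmemD i hi b),
    fun i hi i' hi' hii b => hΔ i hi i' hi' hii _ (hmemD i hi b) _ (hmemD i' hi' b) ?_, ?_⟩
  · rw [hrank i hi, hrank i' hi']
  · intro i hi b b' hbb
    obtain ⟨F, hF, hFc, hsub⟩ := hκ (a i) (ha i hi).1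
    have hk : κ (a i) = k₀ := congrArg Prod.fst (ha i hi).2
    have hkl : κ (a i) ≤ l := by omega
    rcases lt_trichotomy (a i b) (a i b') with h | h | h
    · exact absurd hbb (hS.nrm_lt_nrm hkl hF hFc (hsub (hmem _ _)) (hsub (hmem _ _)) h).ne
    · exact hinj _ (ha i hi).1 h
    · exact absurd hbb.symm (hS.nrm_lt_nrm hkl hF hFc (hsub (hmem _ _)) (hsub (hmem _ _)) h).ne

/-- If `ℱ` is a fully Δ-capturing construction scheme whose type satisfies `n_{k+1} ≥ 2^{m_k}`,
then `𝔼_e = {e_α : α < ω₁}` is `2n`-entangled as a subset of `ℤ^ω` with the lexicographic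
order. -/
theorem stmt3 (T : SchemeType) (ℱ : Set (Finset Ordinal))
    (hS : IsConstructionScheme T ℱ) (hcap : FullyDeltaCapturing T ℱ)
    (hgrow : ∀ k, 2 ^ T.m k ≤ T.n (k + 1))
    (nn : ℕ) (hn : 1 ≤ nn) (C : ℕ → ℕ → Finset ℕ) (hC : IsGoodEnum T nn C) :
    IsNEntangled ((fun α => toLex (eSeq T ℱ C nn α)) '' Set.Iio omegaOne) (2 * nn) := by
  refine ⟨not_countable_range_eSeq hcap C nn, fun τ 𝒜 h𝒜 hdisj hunc => ?_⟩
  have hrep : ∀ a ∈ 𝒜, ∃ α : Fin (2 * nn) → Ordinal, ∀ b, α b < omegaOne ∧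
      toLex (eSeq T ℱ C nn (α b)) = a b := fun a ha => by
    choose α hα using (h𝒜 a ha).2
    exact ⟨α, hα⟩
  choose! g hg using hrep
  have hginj : Set.InjOn g 𝒜 := fun a ha a' ha' h => funext fun b => by
    rw [← (hg a ha b).2, ← (hg a' ha' b).2, h]
  obtain ⟨l, α, hα, hne, hXi, hΔ, hinj⟩ := exists_captured_tuples hS hcap (by omega)
    (not_countable_image hunc hginj)
    (by
      rintro _ ⟨a, ha, rfl⟩ b
      exact (hg a ha b).1)
    (by
      rintro _ ⟨a, ha, rfl⟩ b b' h
      refine (h𝒜 a ha).1.injective ?_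
      rw [← (hg a ha b).2, ← (hg a ha b').2, h])
    (by
      rintro _ ⟨a, ha, rfl⟩ _ ⟨a', ha', rfl⟩ hne b b' h
      refine hdisj ha ha' (fun h' => hne (by rw [h'])) b b' ?_
      rw [← (hg a ha b).2, ← (hg a' ha' b').2, h])
  have hn2 := T.n_ge l
  choose! a ha haα using hα
  have hlt : ∀ i < T.n (l + 1), ∀ b, α i b < omegaOne := fun i hi b => by
    rw [← haα i hi]
    exact (hg _ (ha i hi) b).1
  have hae : ∀ i < T.n (l + 1), ∀ b, a i b = toLex (eSeq T ℱ C nn (α i b)) := fun i hi b => by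
    rw [← haα i hi]
    exact (hg _ (ha i hi) b).2.symm
  have h0 : 0 < T.n (l + 1) := by omega
  let x : Fin (2 * nn) → ℕ := fun b => nrm T ℱ (α 0 b) l
  have hxinj : Function.Injective x := hinj 0 h0
  have hx : ∀ i < T.n (l + 1), 0 < i → ∀ b, nrm T ℱ (α i b) l = x b := fun i hi hi0 b => by
    have hd := hΔ i hi 0 h0 hi0.ne' b
    have hlt' : l < deltaOrd T ℱ (α i b) (α 0 b) := by omega
    simpa using Nat.notMem_of_lt_sInf hlt'
  have : Nonempty (Fin (2 * nn)) := ⟨⟨0, by omega⟩⟩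
  obtain ⟨b₀, hb₀⟩ := Finite.exists_min x
  obtain ⟨Q, hQ, hQc, hQb⟩ := exists_coded_half (Finset.univ.filter fun b => τ b = 0) b₀
  have hcard : (Q.image x).card = Q.card := Finset.card_image_of_injective _ hxinj
  obtain ⟨i, hi0, hi, hCi⟩ := hC.2 l (Q.image x)
    (by
      intro c hc
      obtain ⟨b, -, rfl⟩ := Finset.mem_image.1 hc
      exact Finset.mem_Ico.2 ⟨hS.r_le_nrm (by simp [hXi 0 h0 b]), hS.nrm_lt_m (hlt 0 h0 b) l⟩)
    (hcard.trans_le hQc)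
  have hpos : ∀ b ∈ Q, a 0 b < a i b := fun b hb => by
    rw [hae 0 h0, hae i hi]
    refine toLex_eSeq_lt hS (hlt 0 h0 b) (hlt i hi b) (hΔ 0 h0 i hi hi0.ne b).ge ?_
    rw [eSeq_of_Xi_nonpos (by simp [hXi 0 h0 b]), eSeq_of_pos hi0 (hXi i hi b)]
    · exact_mod_cast hi0
    · rw [hx i hi hi0, hCi]
      exact Finset.mem_image_of_mem x hb
  have hneg : ∀ b ∉ Q, a i b < a 0 b := fun b hb => by
    rw [hae 0 h0, hae i hi]
    refine toLex_eSeq_lt hS (hlt i hi b) (hlt 0 h0 b) (hΔ i hi 0 h0 hi0.ne' b).ge ?_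
    rw [eSeq_of_Xi_nonpos (α := α 0 b) (by simp [hXi 0 h0 b]), eSeq_of_neg hi0 (hXi i hi b)]
    · simpa using hi0
    · rw [hx i hi hi0, hCi, hxinj.mem_finset_image]
      exact hb
    · rw [hx i hi hi0, hCi, hcard]
      rintro ⟨hc, hmin⟩
      exact (hmin _ (Finset.mem_image_of_mem x (hQb hc))).not_ge (hb₀ b)
  have hane : a 0 ≠ a i := fun h => hne 0 h0 i hi hi0.ne (by rw [← haα 0 h0, ← haα i hi, h])
  rcases hQ with rfl | rfl
  · refine ⟨a 0, ha 0 h0, a i, ha i hi, hane, fun b => ⟨fun h => ?_, fun h => hpos b (by simpa)⟩⟩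
    by_contra hb
    exact h.not_gt (hneg b (by simpa))
  · refine ⟨a i, ha i hi, a 0, ha 0 h0, hane.symm,
      fun b => ⟨fun h => ?_, fun h => hneg b (by simpa)⟩⟩
    by_contra hb
    exact h.not_gt (hpos b (by simpa))

end
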